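/- Let n ≥ 2, k = 2^n, let e ⊆ {1,…,n} be a two-element set, and let ℓ ∈ {0,…,k−1} be such that e is not a subset of S_ℓ. Then the vertex v_ℓ belongs to P̄^e_n, the projection of P^e_n onto the coordinates (y_1,z_1). -/

import Mathlib

open Real MeasureTheory Matrix

/-- The clockwise rotation matrix by angle `π / 2 ^ j` (this is `R_{j+1}` in 1-based indexing). -/
noncomputable def rotM (j : ℕ) : Matrix (Fin 2) (Fin 2) ℝ :=
  !![Real.cos (Real.pi / 2 ^ j), Real.sin (Real.pi / 2 ^ j);
     -Real.sin (Real.pi / 2 ^ j), Real.cos (Real.pi / 2 ^ j)]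

/-- The reflection with respect to the first axis. -/
def reflM : Matrix (Fin 2) (Fin 2) ℝ := !![1, 0; 0, -1]

/-- The vertex `v_ℓ = sec(π/2^n) (cos((2ℓ+1)π/2^n), sin((2ℓ+1)π/2^n))` of the regular `2^n`-gon. -/
noncomputable def vtx (n ℓ : ℕ) : Fin 2 → ℝ :=
  (Real.cos (Real.pi / 2 ^ n))⁻¹ •
    ![Real.cos ((2 * ℓ + 1) * Real.pi / 2 ^ n), Real.sin ((2 * ℓ + 1) * Real.pi / 2 ^ n)]

/-- The facet midpoint `w_ℓ = (cos((2ℓ+2)π/2^n), sin((2ℓ+2)π/2^n))`. -/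
noncomputable def wpt (n ℓ : ℕ) : Fin 2 → ℝ :=
  ![Real.cos ((2 * ℓ + 2) * Real.pi / 2 ^ n), Real.sin ((2 * ℓ + 2) * Real.pi / 2 ^ n)]

/-- `chainAux n b x i = R^{b_i} R_i ⋯ R^{b_1} R_1 x` (1-based indexing of `b` and `R`). -/
noncomputable def chainAux (n : ℕ) (b : Fin n → Fin 2) (x : Fin 2 → ℝ) : ℕ → Fin 2 → ℝ
  | 0 => x
  | i + 1 =>
    if h : i < n then
      (reflM ^ ((b ⟨i, h⟩ : Fin 2) : ℕ)) *ᵥ (rotM i *ᵥ chainAux n b x i)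
    else chainAux n b x i
/-- The polyhedron `P^∅_n` in the space of pairs `(y, z)` (0-based: `y i` is `y_{i+1}`). -/
def Pempty (n : ℕ) : Set ((Fin (n + 1) → ℝ) × (Fin (n + 1) → ℝ)) :=
  {p | (∀ i : Fin n,
        p.1 i.succ = Real.cos (Real.pi / 2 ^ (i : ℕ)) * p.1 i.castSucc
            + Real.sin (Real.pi / 2 ^ (i : ℕ)) * p.2 i.castSucc ∧
        p.2 i.succ ≥ -Real.sin (Real.pi / 2 ^ (i : ℕ)) * p.1 i.castSucc
            + Real.cos (Real.pi / 2 ^ (i : ℕ)) * p.2 i.castSucc ∧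
        p.2 i.succ ≥ Real.sin (Real.pi / 2 ^ (i : ℕ)) * p.1 i.castSucc
            - Real.cos (Real.pi / 2 ^ (i : ℕ)) * p.2 i.castSucc) ∧
    p.1 (Fin.last n) ≤ 1 ∧
    Real.cos (Real.pi / 2 ^ (n - 1)) * p.1 (Fin.last n)
        + Real.sin (Real.pi / 2 ^ (n - 1)) * p.2 (Fin.last n) ≤ 1}

/-- The polyhedron `P^e_n` for an edge `e` (0-based indexing of `{1,…,n}` as `Fin n`). -/
def Pe (n : ℕ) (e : Finset (Fin n)) : Set ((Fin (n + 1) → ℝ) × (Fin (n + 1) → ℝ)) :=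
  {p | (∀ i : Fin n,
        p.1 i.succ = Real.cos (Real.pi / 2 ^ (i : ℕ)) * p.1 i.castSucc
            + Real.sin (Real.pi / 2 ^ (i : ℕ)) * p.2 i.castSucc ∧
        (if i ∈ e then
          p.2 i.succ = -Real.sin (Real.pi / 2 ^ (i : ℕ)) * p.1 i.castSucc
              + Real.cos (Real.pi / 2 ^ (i : ℕ)) * p.2 i.castSucc
        else
          p.2 i.succ ≥ -Real.sin (Real.pi / 2 ^ (i : ℕ)) * p.1 i.castSucc
              + Real.cos (Real.pi / 2 ^ (i : ℕ)) * p.2 i.castSucc ∧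
          p.2 i.succ ≥ Real.sin (Real.pi / 2 ^ (i : ℕ)) * p.1 i.castSucc
              - Real.cos (Real.pi / 2 ^ (i : ℕ)) * p.2 i.castSucc)) ∧
    Real.cos (Real.pi / 2 ^ n) * p.1 (Fin.last n)
        + Real.sin (Real.pi / 2 ^ n) * p.2 (Fin.last n) ≤ Real.cos (Real.pi / 2 ^ n)}

/-- Projection of a pair `(y, z)` to the coordinates `(y_1, z_1)`. -/
def proj2 {n : ℕ} (p : (Fin (n + 1) → ℝ) × (Fin (n + 1) → ℝ)) : Fin 2 → ℝ :=
  ![p.1 0, p.2 0]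

/-- The regular `2^n`-gon `Q_{2^n}`, as the convex hull of its vertices. -/
def Qgon (n : ℕ) : Set (Fin 2 → ℝ) :=
  convexHull ℝ {x | ∃ ℓ < 2 ^ n, x = vtx n ℓ}

/-- The triangle `Δ_ℓ` spanned by `w_{ℓ-1}`, `v_ℓ` and `w_ℓ` (indices mod `2^n`). -/
def tri (n ℓ : ℕ) : Set (Fin 2 → ℝ) :=
  convexHull ℝ {wpt n (ℓ + 2 ^ n - 1), vtx n ℓ, wpt n ℓ}


/-- The point at angle `t` on the circle circumscribed to the regular `2^n`-gon. -/
noncomputable def circumPt (n : ℕ) (t : ℝ) : Fin 2 → ℝ :=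
  (Real.cos (π / 2 ^ n))⁻¹ • ![Real.cos t, Real.sin t]

lemma circumPt_zero (n : ℕ) (t : ℝ) :
    circumPt n t 0 = (Real.cos (π / 2 ^ n))⁻¹ * Real.cos t := by
  simp [circumPt]

lemma circumPt_one (n : ℕ) (t : ℝ) :
    circumPt n t 1 = (Real.cos (π / 2 ^ n))⁻¹ * Real.sin t := by
  simp [circumPt]

lemma vtx_eq_circumPt (n ℓ : ℕ) : vtx n ℓ = circumPt n ((2 * ℓ + 1) * π / 2 ^ n) := rfl

lemma rotM_mulVec_zero (j : ℕ) (x : Fin 2 → ℝ) :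
    (rotM j *ᵥ x) 0 = Real.cos (π / 2 ^ j) * x 0 + Real.sin (π / 2 ^ j) * x 1 := by
  simp [rotM, Matrix.mulVec, dotProduct, Fin.sum_univ_two]

lemma rotM_mulVec_one (j : ℕ) (x : Fin 2 → ℝ) :
    (rotM j *ᵥ x) 1 = -Real.sin (π / 2 ^ j) * x 0 + Real.cos (π / 2 ^ j) * x 1 := by
  simp [rotM, Matrix.mulVec, dotProduct, Fin.sum_univ_two]

lemma reflM_mulVec_zero (x : Fin 2 → ℝ) : (reflM *ᵥ x) 0 = x 0 := by
  simp [reflM, Matrix.mulVec, dotProduct, Fin.sum_univ_two]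

lemma reflM_mulVec_one (x : Fin 2 → ℝ) : (reflM *ᵥ x) 1 = -x 1 := by
  simp [reflM, Matrix.mulVec, dotProduct, Fin.sum_univ_two]

lemma fin_two_fun_ext {x y : Fin 2 → ℝ} (h₀ : x 0 = y 0) (h₁ : x 1 = y 1) : x = y := by
  ext i
  fin_cases i
  · exact h₀
  · exact h₁

lemma reflM_mulVec_reflM_mulVec (x : Fin 2 → ℝ) : reflM *ᵥ (reflM *ᵥ x) = x :=
  fin_two_fun_ext (by simp only [reflM_mulVec_zero])
    (by simp only [reflM_mulVec_one, neg_neg])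

lemma reflM_mulVec_circumPt (n : ℕ) (t : ℝ) :
    reflM *ᵥ circumPt n t = circumPt n (-t) := by
  refine fin_two_fun_ext ?_ ?_
  · rw [reflM_mulVec_zero, circumPt_zero, circumPt_zero, Real.cos_neg]
  · rw [reflM_mulVec_one, circumPt_one, circumPt_one, Real.sin_neg, mul_neg]

lemma rotM_mulVec_eq_circumPt_iff (n j : ℕ) (x : Fin 2 → ℝ) (t : ℝ) :
    rotM j *ᵥ x = circumPt n t ↔ x = circumPt n (t + π / 2 ^ j) := by
  have hsq := Real.sin_sq_add_cos_sq (π / 2 ^ j)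
  constructor
  · intro h
    have h₀ := congrFun h 0
    have h₁ := congrFun h 1
    rw [rotM_mulVec_zero, circumPt_zero] at h₀
    rw [rotM_mulVec_one, circumPt_one] at h₁
    refine fin_two_fun_ext ?_ ?_
    · rw [circumPt_zero, Real.cos_add]
      linear_combination Real.cos (π / 2 ^ j) * h₀ - Real.sin (π / 2 ^ j) * h₁ - x 0 * hsq
    · rw [circumPt_one, Real.sin_add]
      linear_combination Real.sin (π / 2 ^ j) * h₀ + Real.cos (π / 2 ^ j) * h₁ - x 1 * hsq
  · rintro rfl
    refine fin_two_fun_ext ?_ ?_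
    · rw [rotM_mulVec_zero, circumPt_zero, circumPt_zero, circumPt_one, Real.cos_add,
        Real.sin_add]
      linear_combination (Real.cos (π / 2 ^ n))⁻¹ * Real.cos t * hsq
    · rw [rotM_mulVec_one, circumPt_one, circumPt_zero, circumPt_one, Real.cos_add,
        Real.sin_add]
      linear_combination (Real.cos (π / 2 ^ n))⁻¹ * Real.sin t * hsq

lemma rotM_mulVec_circumPt (n j : ℕ) (t : ℝ) :
    rotM j *ᵥ circumPt n t = circumPt n (t - π / 2 ^ j) := by
  rw [rotM_mulVec_eq_circumPt_iff, sub_add_cancel]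

/-- The first `n` steps of `p` are the successive rotations, each optionally followed by the
reflection. -/
def IsFoldPath (n : ℕ) (p : ℕ → Fin 2 → ℝ) : Prop :=
  ∀ i < n, p (i + 1) = rotM i *ᵥ p i ∨ p (i + 1) = reflM *ᵥ (rotM i *ᵥ p i)

/-- A path starting at a vertex of the regular `2^n`-gon stays among the vertices. -/
lemma IsFoldPath.exists_eq_circumPt {n : ℕ} {p : ℕ → Fin 2 → ℝ} (hp : IsFoldPath n p)
    {ℓ : ℕ} (h₀ : p 0 = vtx n ℓ) {i : ℕ} (hi : i ≤ n) :
    ∃ m : ℤ, p i = circumPt n ((2 * m + 1) * π / 2 ^ n) := by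
  induction i with
  | zero => exact ⟨ℓ, by rw [h₀, vtx_eq_circumPt, Int.cast_natCast]⟩
  | succ i ih =>
    obtain ⟨m, hm⟩ := ih (by omega)
    obtain ⟨d, rfl⟩ : ∃ d, n = i + d + 1 := ⟨n - i - 1, by omega⟩
    have hrot : rotM i *ᵥ p i
        = circumPt (i + d + 1) ((2 * ((m - 2 ^ d : ℤ) : ℝ) + 1) * π / 2 ^ (i + d + 1)) := by
      rw [hm, rotM_mulVec_circumPt]
      congr 1
      push_cast
      field_simp
      ring
    rcases hp i (by omega) with h | h
    · exact ⟨m - 2 ^ d, h.trans hrot⟩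
    · refine ⟨-(m - 2 ^ d) - 1, ?_⟩
      rw [h, hrot, reflM_mulVec_circumPt]
      congr 1
      push_cast
      ring

/-- A path ending at `v_0` is at an angle in `(0, 2π / 2 ^ i)` before step `i`. -/
lemma IsFoldPath.exists_angle {n : ℕ} {p : ℕ → Fin 2 → ℝ} (hp : IsFoldPath n p)
    (hend : p n = vtx n 0) {i : ℕ} (hi : i ≤ n) :
    ∃ t : ℝ, 0 < t ∧ t < 2 * (π / 2 ^ i) ∧ p i = circumPt n t := by
  induction hi using Nat.decreasingInduction with
  | self =>
    have hpos : 0 < π / 2 ^ n := by positivity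
    refine ⟨π / 2 ^ n, hpos, by linarith, ?_⟩
    rw [hend, vtx_eq_circumPt]
    simp
  | of_succ i hi ih =>
    obtain ⟨t, ht, ht', h⟩ := ih
    have hhalf : 2 * (π / 2 ^ (i + 1)) = π / 2 ^ i := by
      rw [pow_succ]
      field_simp
    rw [hhalf] at ht'
    rcases hp i hi with hstep | hstep
    · refine ⟨t + π / 2 ^ i, by linarith, by linarith, ?_⟩
      rw [← rotM_mulVec_eq_circumPt_iff, ← hstep, h]
    · refine ⟨-t + π / 2 ^ i, by linarith, by linarith, ?_⟩
      rw [← rotM_mulVec_eq_circumPt_iff, ← reflM_mulVec_circumPt, ← h, hstep,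
        reflM_mulVec_reflM_mulVec]

lemma cos_pi_div_two_pow_pos {n : ℕ} (hn : 2 ≤ n) : 0 < Real.cos (π / 2 ^ n) := by
  have hpos : 0 < π / 2 ^ n := by positivity
  refine Real.cos_pos_of_mem_Ioo ⟨by linarith [Real.pi_pos], ?_⟩
  refine div_lt_div_of_pos_left Real.pi_pos two_pos ?_
  exact lt_self_pow₀ one_lt_two (by omega)

lemma IsFoldPath.one_pos {n : ℕ} (hn : 2 ≤ n) {p : ℕ → Fin 2 → ℝ} (hp : IsFoldPath n p)
    (hend : p n = vtx n 0) {i : ℕ} (hi : i < n) : 0 < p (i + 1) 1 := by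
  obtain ⟨t, ht, ht', h⟩ := hp.exists_angle hend (Nat.succ_le_of_lt hi)
  have hle : 2 * (π / 2 ^ (i + 1)) ≤ π := by
    rw [pow_succ, ← div_div, mul_div_cancel₀ _ two_ne_zero]
    exact div_le_self Real.pi_pos.le (one_le_pow₀ one_le_two)
  rw [h, circumPt_one]
  exact mul_pos (inv_pos.2 (cos_pi_div_two_pow_pos hn))
    (Real.sin_pos_of_pos_of_lt_pi ht (ht'.trans_le hle))

/-- A path from a given point to `v_0` is unique. -/
lemma IsFoldPath.eq_of_end_eq {n : ℕ} (hn : 2 ≤ n) {p q : ℕ → Fin 2 → ℝ}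
    (hp : IsFoldPath n p) (hq : IsFoldPath n q) (h₀ : p 0 = q 0)
    (hpend : p n = vtx n 0) (hqend : q n = vtx n 0) {i : ℕ} (hi : i ≤ n) : p i = q i := by
  induction i with
  | zero => exact h₀
  | succ i ih =>
    have hi' : i < n := hi
    have hpq := ih hi'.le
    have hppos := hp.one_pos hn hpend hi'
    have hqpos := hq.one_pos hn hqend hi'
    rcases hp i hi' with h | h <;> rcases hq i hi' with h' | h'
    · rw [h, h', hpq]
    · rw [h, hpq] at hppos
      rw [h', reflM_mulVec_one] at hqpos
      linarith
    · rw [h, hpq, reflM_mulVec_one] at hppos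
      rw [h'] at hqpos
      linarith
    · rw [h, h', hpq]

lemma isFoldPath_chainAux (n : ℕ) (b : Fin n → Fin 2) (x : Fin 2 → ℝ) :
    IsFoldPath n (chainAux n b x) := by
  intro i hi
  rw [chainAux, dif_pos hi]
  obtain h | h : b ⟨i, hi⟩ = 0 ∨ b ⟨i, hi⟩ = 1 := by omega
  · left
    rw [h, Fin.val_zero, pow_zero, Matrix.one_mulVec]
  · right
    rw [h, Fin.val_one, pow_one]

/-- The path that rotates at the steps in `e`, and otherwise rotates and then replaces the second
coordinate by its absolute value. -/
noncomputable def absPath {n : ℕ} (e : Finset (Fin n)) (x : Fin 2 → ℝ) : ℕ → Fin 2 → ℝ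
  | 0 => x
  | i + 1 =>
    open Classical in
    if ∃ h : i < n, (⟨i, h⟩ : Fin n) ∈ e then rotM i *ᵥ absPath e x i
    else ![(rotM i *ᵥ absPath e x i) 0, |(rotM i *ᵥ absPath e x i) 1|]

lemma absPath_succ_of_mem {n : ℕ} {e : Finset (Fin n)} (x : Fin 2 → ℝ) {i : Fin n}
    (hi : i ∈ e) : absPath e x (i + 1) = rotM i *ᵥ absPath e x i := by
  rw [absPath, if_pos ⟨i.2, hi⟩]

lemma absPath_succ_of_notMem {n : ℕ} {e : Finset (Fin n)} (x : Fin 2 → ℝ) {i : Fin n}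
    (hi : i ∉ e) : absPath e x (i + 1)
      = ![(rotM i *ᵥ absPath e x i) 0, |(rotM i *ᵥ absPath e x i) 1|] := by
  rw [absPath, if_neg fun ⟨_, h⟩ => hi h]

lemma isFoldPath_absPath {n : ℕ} (e : Finset (Fin n)) (x : Fin 2 → ℝ) :
    IsFoldPath n (absPath e x) := by
  intro i hi
  by_cases h : (⟨i, hi⟩ : Fin n) ∈ e
  · exact Or.inl (absPath_succ_of_mem x h)
  · have hstep : absPath e x (i + 1) = _ := absPath_succ_of_notMem x h
    have hzero : absPath e x (i + 1) 0 = (rotM i *ᵥ absPath e x i) 0 := congrFun hstep 0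
    have hone : absPath e x (i + 1) 1 = |(rotM i *ᵥ absPath e x i) 1| := congrFun hstep 1
    rcases abs_choice ((rotM i *ᵥ absPath e x i) 1) with habs | habs
    · exact Or.inl (fin_two_fun_ext hzero (hone.trans habs))
    · refine Or.inr (fin_two_fun_ext ?_ ?_)
      · rw [hzero, reflM_mulVec_zero]
      · rw [hone, habs, reflM_mulVec_one]

lemma absPath_ne_vtx_zero {n : ℕ} (hn : 2 ≤ n) (e : Finset (Fin n)) (b : Fin n → Fin 2)
    (x : Fin 2 → ℝ) (hb : chainAux n b x n = vtx n 0) (hS : ¬ ∀ i ∈ e, b i = 0) :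
    absPath e x n ≠ vtx n 0 := by
  intro hend
  push Not at hS
  obtain ⟨i, hie, hbi⟩ := hS
  have hb₁ : b i = 1 := by omega
  have heq {j : ℕ} (hj : j ≤ n) : chainAux n b x j = absPath e x j :=
    (isFoldPath_chainAux n b x).eq_of_end_eq hn (isFoldPath_absPath e x) rfl hb hend hj
  have hpos := (isFoldPath_absPath e x).one_pos hn hend i.2
  have hchain : chainAux n b x (i + 1) = reflM *ᵥ (rotM i *ᵥ chainAux n b x i) := by
    rw [chainAux, dif_pos i.2, Fin.eta, hb₁, Fin.val_one, pow_one]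
  rw [heq i.2, heq i.2.le] at hchain
  have hneg := congrFun hchain 1
  rw [reflM_mulVec_one, ← absPath_succ_of_mem x hie] at hneg
  linarith

/-- Any vertex other than `v_0` satisfies the final inequality of `Pe`. -/
lemma circumPt_le_of_ne_vtx_zero {n : ℕ} (hn : 2 ≤ n) (m : ℤ)
    (hne : circumPt n ((2 * m + 1) * π / 2 ^ n) ≠ vtx n 0) :
    Real.cos (π / 2 ^ n) * circumPt n ((2 * m + 1) * π / 2 ^ n) 0
      + Real.sin (π / 2 ^ n) * circumPt n ((2 * m + 1) * π / 2 ^ n) 1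
      ≤ Real.cos (π / 2 ^ n) := by
  have hpow : (0 : ℝ) < 2 ^ n := by positivity
  set θ := π / 2 ^ n with hθ
  have hθpos : 0 < θ := by positivity
  have hθπ : 2 ^ n * θ = π := by rw [hθ]; field_simp
  have hc : 0 < Real.cos θ := cos_pi_div_two_pow_pos hn
  set r := m % 2 ^ n with hr
  have hr₀ : 0 ≤ r := Int.emod_nonneg _ (by positivity)
  have hr₁ : r < 2 ^ n := Int.emod_lt_of_pos _ (by positivity)
  obtain ⟨q, hq⟩ : ∃ q : ℤ, m = r + q * 2 ^ n :=
    ⟨m / 2 ^ n, by rw [hr, mul_comm, Int.emod_add_mul_ediv]⟩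
  have hang : (2 * m + 1) * π / 2 ^ n = (2 * r * θ + θ) + q * (2 * π) := by
    rw [hq, ← hθπ, hθ]
    push_cast
    field_simp
    ring
  have hpt : circumPt n ((2 * m + 1) * π / 2 ^ n) = circumPt n (2 * r * θ + θ) := by
    rw [hang, circumPt, circumPt, Real.cos_add_int_mul_two_pi, Real.sin_add_int_mul_two_pi]
  rw [hpt] at hne ⊢
  have hrpos : 1 ≤ r := by
    by_contra! hlt
    obtain hr₂ : r = 0 := by omega
    apply hne
    rw [hr₂, vtx_eq_circumPt, hθ]
    simp
  have hr₃ : (1 : ℝ) ≤ r := by exact_mod_cast hrpos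
  have hr₄ : (r : ℝ) + 1 ≤ 2 ^ n := by exact_mod_cast hr₁
  have hcos : Real.cos (2 * r * θ) ≤ Real.cos (2 * θ) := by
    rcases le_total (2 * r * θ) π with h | h
    · exact Real.cos_le_cos_of_nonneg_of_le_pi (by positivity) h (by nlinarith)
    · rw [← Real.cos_two_pi_sub (2 * r * θ)]
      exact Real.cos_le_cos_of_nonneg_of_le_pi (by positivity) (by linarith) (by nlinarith)
  have hlhs : Real.cos θ * circumPt n (2 * r * θ + θ) 0
      + Real.sin θ * circumPt n (2 * r * θ + θ) 1 = (Real.cos θ)⁻¹ * Real.cos (2 * r * θ) := by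
    rw [circumPt_zero, circumPt_one, ← hθ, Real.cos_add, Real.sin_add]
    linear_combination (Real.cos θ)⁻¹ * Real.cos (2 * r * θ) * Real.sin_sq_add_cos_sq θ
  rw [hlhs, inv_mul_le_iff₀ hc]
  rw [Real.cos_two_mul] at hcos
  nlinarith [Real.cos_sq_le_one θ]

/-- If `e ⊄ S_ℓ`, then the vertex `v_ℓ` belongs to the projection of `P^e_n` onto
`(y_1, z_1)`. -/
theorem vtx_mem_proj_Pe (n : ℕ) (hn : 2 ≤ n)
    (e : Finset (Fin n)) (he : e.card = 2)
    (ℓ : ℕ) (hℓ : ℓ < 2 ^ n)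
    (b : Fin n → Fin 2) (hb : chainAux n b (vtx n ℓ) n = vtx n 0)
    (hS : ¬ ∀ i ∈ e, b i = 0) :
    vtx n ℓ ∈ proj2 '' Pe n e := by
  have hfold := isFoldPath_absPath e (vtx n ℓ)
  have hrot (i : Fin n) : absPath e (vtx n ℓ) (i + 1) 0
      = (rotM i *ᵥ absPath e (vtx n ℓ) i) 0 := by
    rcases hfold i i.2 with h | h
    · rw [h]
    · rw [h, reflM_mulVec_zero]
  refine ⟨(fun i => absPath e (vtx n ℓ) i 0, fun i => absPath e (vtx n ℓ) i 1),
    ⟨fun i => ⟨?_, ?_⟩, ?_⟩, ?_⟩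
  · simpa only [Fin.val_succ, Fin.val_castSucc, rotM_mulVec_zero] using hrot i
  · simp only [Fin.val_succ, Fin.val_castSucc, ge_iff_le]
    have hrot₁ := rotM_mulVec_one i (absPath e (vtx n ℓ) i)
    split_ifs with hi
    · rw [absPath_succ_of_mem _ hi, hrot₁]
    · have habs : absPath e (vtx n ℓ) (i + 1) 1 = |(rotM i *ᵥ absPath e (vtx n ℓ) i) 1| := by
        rw [absPath_succ_of_notMem _ hi]
        rfl
      rw [habs, hrot₁]
      refine ⟨le_abs_self _, le_trans (le_of_eq ?_) (neg_le_abs _)⟩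
      ring
  · obtain ⟨m, hm⟩ := hfold.exists_eq_circumPt (ℓ := ℓ) rfl le_rfl
    have hne := absPath_ne_vtx_zero hn e b (vtx n ℓ) hb hS
    simp only [Fin.val_last]
    rw [hm] at hne ⊢
    exact circumPt_le_of_ne_vtx_zero hn m hne
  · exact fin_two_fun_ext rfl rfl
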